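/- The intuitionistic tense logic IK_t of Ewald is deductively equivalent to Int2GC+FS: under the identification of the tense connectives F, G, P, H with ◆, ■, ◇, □ respectively, a formula is provable in IK_t if and only if it is provable in Int2GC+FS. -/

import Mathlib

/-- Formulas of the modal language with four unary modalities:
`dia1` = ◆, `box1` = □, `dia2` = ◇, `box2` = ■. -/
inductive Fm : Type
  | var : ℕ → Fm
  | and : Fm → Fm → Fm
  | or  : Fm → Fm → Fm
  | imp : Fm → Fm → Fm
  | neg : Fm → Fm
  | dia1 : Fm → Fm
  | box1 : Fm → Fm
  | dia2 : Fm → Fm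
  | box2 : Fm → Fm

/-- Instances of the axiom schemes of intuitionistic propositional logic. -/
inductive IntAx : Fm → Prop
  | a1 (A B : Fm) : IntAx (.imp A (.imp B A))
  | a2 (A B C : Fm) : IntAx (.imp (.imp A (.imp B C)) (.imp (.imp A B) (.imp A C)))
  | a3 (A B : Fm) : IntAx (.imp (.and A B) A)
  | a4 (A B : Fm) : IntAx (.imp (.and A B) B)
  | a5 (A B : Fm) : IntAx (.imp A (.imp B (.and A B)))
  | a6 (A B : Fm) : IntAx (.imp A (.or A B))
  | a7 (A B : Fm) : IntAx (.imp B (.or A B))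
  | a8 (A B C : Fm) : IntAx (.imp (.imp A C) (.imp (.imp B C) (.imp (.or A B) C)))
  | a9 (A B : Fm) : IntAx (.imp (.imp A B) (.imp (.imp A (.neg B)) (.neg A)))
  | a10 (A B : Fm) : IntAx (.imp (.neg A) (.imp A B))

/-- Provability in the extension of Int2GC by the extra axiom scheme `Ax`:
the smallest set of formulas containing all intuitionistic axiom instances and all
instances of `Ax`, closed under modus ponens and the four Galois-connection rules. -/
inductive Prov (Ax : Fm → Prop) : Fm → Prop
  | intAx {A : Fm} : IntAx A → Prov Ax A
  | extra {A : Fm} : Ax A → Prov Ax A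
  | mp {A B : Fm} : Prov Ax (.imp A B) → Prov Ax A → Prov Ax B
  | gc1 {A B : Fm} : Prov Ax (.imp A (.box1 B)) → Prov Ax (.imp (.dia1 A) B)
  | gc2 {A B : Fm} : Prov Ax (.imp (.dia1 A) B) → Prov Ax (.imp A (.box1 B))
  | gc3 {A B : Fm} : Prov Ax (.imp A (.box2 B)) → Prov Ax (.imp (.dia2 A) B)
  | gc4 {A B : Fm} : Prov Ax (.imp (.dia2 A) B) → Prov Ax (.imp A (.box2 B))

/-- The empty extra axiom scheme: `Prov NoAx` is provability in Int2GC itself. -/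
def NoAx : Fm → Prop := fun _ => False

/-- Instances of (FS1): ◆(A → B) → (■A → ◆B). -/
def FS1Ax (C : Fm) : Prop := ∃ A B : Fm, C = .imp (.dia1 (.imp A B)) (.imp (.box2 A) (.dia1 B))
/-- Instances of (FS2): ◇(A → B) → (□A → ◇B). -/
def FS2Ax (C : Fm) : Prop := ∃ A B : Fm, C = .imp (.dia2 (.imp A B)) (.imp (.box1 A) (.dia2 B))
/-- Instances of (FS3): (◆A → ■B) → ■(A → B). -/
def FS3Ax (C : Fm) : Prop := ∃ A B : Fm, C = .imp (.imp (.dia1 A) (.box2 B)) (.box2 (.imp A B))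
/-- Instances of (FS4): (◇A → □B) → □(A → B). -/
def FS4Ax (C : Fm) : Prop := ∃ A B : Fm, C = .imp (.imp (.dia2 A) (.box1 B)) (.box1 (.imp A B))
/-- The Fischer Servi scheme (FS1)+(FS2); `Prov FSAx` is provability in Int2GC+FS. -/
def FSAx (C : Fm) : Prop := FS1Ax C ∨ FS2Ax C

/-- `A ↔ B` as a formula: `(A → B) ∧ (B → A)`. -/
def Fm.iffF (A B : Fm) : Fm := .and (.imp A B) (.imp B A)

/-- Ewald's intuitionistic tense logic IK_t, with the tense connectives
`F`, `G`, `P`, `H` written as `dia1` (◆), `box2` (■), `dia2` (◇), `box1` (□). -/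
inductive IKt : Fm → Prop
  | intAx {A : Fm} : IntAx A → IKt A
  | mp {A B : Fm} : IKt (.imp A B) → IKt A → IKt B
  | rG {A : Fm} : IKt A → IKt (.box2 A)
  | rH {A : Fm} : IKt A → IKt (.box1 A)
  | ax2 (A B : Fm) : IKt (.imp (.box2 (.imp A B)) (.imp (.box2 A) (.box2 B)))
  | ax2' (A B : Fm) : IKt (.imp (.box1 (.imp A B)) (.imp (.box1 A) (.box1 B)))
  | ax3 (A B : Fm) : IKt (Fm.iffF (.box2 (.and A B)) (.and (.box2 A) (.box2 B)))
  | ax3' (A B : Fm) : IKt (Fm.iffF (.box1 (.and A B)) (.and (.box1 A) (.box1 B)))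
  | ax4 (A B : Fm) : IKt (Fm.iffF (.dia1 (.or A B)) (.or (.dia1 A) (.dia1 B)))
  | ax4' (A B : Fm) : IKt (Fm.iffF (.dia2 (.or A B)) (.or (.dia2 A) (.dia2 B)))
  | ax5 (A B : Fm) : IKt (.imp (.box2 (.imp A B)) (.imp (.dia1 A) (.dia1 B)))
  | ax5' (A B : Fm) : IKt (.imp (.box1 (.imp A B)) (.imp (.dia2 A) (.dia2 B)))
  | ax6 (A B : Fm) : IKt (.imp (.and (.box2 A) (.dia1 B)) (.dia1 (.and A B)))
  | ax6' (A B : Fm) : IKt (.imp (.and (.box1 A) (.dia2 B)) (.dia2 (.and A B)))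
  | ax7 (A : Fm) : IKt (.imp (.box2 (.neg A)) (.neg (.dia1 A)))
  | ax7' (A : Fm) : IKt (.imp (.box1 (.neg A)) (.neg (.dia2 A)))
  | ax8 (A : Fm) : IKt (.imp (.dia1 (.box1 A)) A)
  | ax8' (A : Fm) : IKt (.imp (.dia2 (.box2 A)) A)
  | ax9 (A : Fm) : IKt (.imp A (.box1 (.dia1 A)))
  | ax9' (A : Fm) : IKt (.imp A (.box2 (.dia2 A)))
  | ax10 (A B : Fm) : IKt (.imp (.imp (.dia1 A) (.box2 B)) (.box2 (.imp A B)))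
  | ax10' (A B : Fm) : IKt (.imp (.imp (.dia2 A) (.box1 B)) (.box1 (.imp A B)))
  | ax11 (A B : Fm) : IKt (.imp (.dia1 (.imp A B)) (.imp (.box2 A) (.dia1 B)))
  | ax11' (A B : Fm) : IKt (.imp (.dia2 (.imp A B)) (.imp (.box1 A) (.dia2 B)))

/-- Hypothetical syllogism for any set of formulas containing the intuitionistic axioms and
closed under modus ponens. -/
theorem imp_trans_of_closed {T : Fm → Prop} (ax : ∀ {A}, IntAx A → T A)
    (mp : ∀ {A B}, T (.imp A B) → T A → T B) {A B C : Fm}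
    (h₁ : T (.imp A B)) (h₂ : T (.imp B C)) : T (.imp A C) :=
  mp (mp (ax (.a2 A B C)) (mp (ax (.a1 _ A)) h₂)) h₁

namespace IKt

theorem trans {A B C : Fm} (h₁ : IKt (.imp A B)) (h₂ : IKt (.imp B C)) : IKt (.imp A C) :=
  imp_trans_of_closed intAx mp h₁ h₂

theorem of_prov {A : Fm} (h : Prov FSAx A) : IKt A := by
  induction h with
  | intAx h => exact intAx h
  | extra h =>
    rcases h with ⟨A, B, rfl⟩ | ⟨A, B, rfl⟩
    · exact ax11 A B
    · exact ax11' A B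
  | mp _ _ h₁ h₂ => exact mp h₁ h₂
  | gc1 _ h => exact trans (mp (ax5 _ _) (rG h)) (ax8 _)
  | gc2 _ h => exact trans (ax9 _) (mp (ax2' _ _) (rH h))
  | gc3 _ h => exact trans (mp (ax5' _ _) (rH h)) (ax8' _)
  | gc4 _ h => exact trans (ax9' _) (mp (ax2 _ _) (rG h))

end IKt

namespace Prov

section Basic

variable {Ax : Fm → Prop} {A B C : Fm}

theorem trans (h₁ : Prov Ax (.imp A B)) (h₂ : Prov Ax (.imp B C)) : Prov Ax (.imp A C) :=
  imp_trans_of_closed intAx mp h₁ h₂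

theorem weaken (h : Prov Ax B) : Prov Ax (.imp A B) := mp (intAx (.a1 B A)) h

theorem imp_mp (h₁ : Prov Ax (.imp A (.imp B C))) (h₂ : Prov Ax (.imp A B)) :
    Prov Ax (.imp A C) :=
  mp (mp (intAx (.a2 A B C)) h₁) h₂

theorem imp_refl (A : Fm) : Prov Ax (.imp A A) :=
  imp_mp (B := .imp A A) (intAx (.a1 _ _)) (intAx (.a1 _ _))

theorem and_left (A B : Fm) : Prov Ax (.imp (.and A B) A) := intAx (.a3 A B)

theorem and_right (A B : Fm) : Prov Ax (.imp (.and A B) B) := intAx (.a4 A B)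

theorem imp_and (h₁ : Prov Ax (.imp C A)) (h₂ : Prov Ax (.imp C B)) :
    Prov Ax (.imp C (.and A B)) :=
  imp_mp (trans h₁ (intAx (.a5 A B))) h₂

theorem curry (h : Prov Ax (.imp (.and A B) C)) : Prov Ax (.imp A (.imp B C)) :=
  trans (intAx (.a5 A B)) (mp (intAx (.a2 _ _ _)) (weaken h))

theorem uncurry (h : Prov Ax (.imp A (.imp B C))) : Prov Ax (.imp (.and A B) C) :=
  imp_mp (trans (and_left A B) h) (and_right A B)

theorem imp_swap (h : Prov Ax (.imp A (.imp B C))) : Prov Ax (.imp B (.imp A C)) :=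
  curry (imp_mp (trans (and_right B A) h) (and_left B A))

theorem or_imp (h₁ : Prov Ax (.imp A C)) (h₂ : Prov Ax (.imp B C)) :
    Prov Ax (.imp (.or A B) C) :=
  mp (mp (intAx (.a8 A B C)) h₁) h₂

theorem imp_neg (h : ∀ D, Prov Ax (.imp (.and A B) D)) : Prov Ax (.imp A (.neg B)) :=
  imp_mp (trans (curry (h B)) (intAx (.a9 _ _))) (curry (h (.neg B)))

theorem neg_and_self_imp (A B : Fm) : Prov Ax (.imp (.and (.neg A) A) B) :=
  uncurry (intAx (.a10 A B))

/-- Contravariance in the premise and covariance in the conclusion of an implication. -/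
theorem imp_congr {D : Fm} (h₁ : Prov Ax (.imp C A)) (h₂ : Prov Ax (.imp B D)) :
    Prov Ax (.imp (.imp A B) (.imp C D)) :=
  curry (trans (imp_mp (and_left _ _) (trans (and_right _ _) h₁)) h₂)

theorem iffF_intro (h₁ : Prov Ax (.imp A B)) (h₂ : Prov Ax (.imp B A)) :
    Prov Ax (Fm.iffF A B) :=
  mp (mp (intAx (.a5 _ _)) h₁) h₂

theorem dia1_box1 (A : Fm) : Prov Ax (.imp (.dia1 (.box1 A)) A) := gc1 (imp_refl _)

theorem dia2_box2 (A : Fm) : Prov Ax (.imp (.dia2 (.box2 A)) A) := gc3 (imp_refl _)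

theorem box1_dia1 (A : Fm) : Prov Ax (.imp A (.box1 (.dia1 A))) := gc2 (imp_refl _)

theorem box2_dia2 (A : Fm) : Prov Ax (.imp A (.box2 (.dia2 A))) := gc4 (imp_refl _)

theorem dia1_mono (h : Prov Ax (.imp A B)) : Prov Ax (.imp (.dia1 A) (.dia1 B)) :=
  gc1 (trans h (box1_dia1 B))

theorem dia2_mono (h : Prov Ax (.imp A B)) : Prov Ax (.imp (.dia2 A) (.dia2 B)) :=
  gc3 (trans h (box2_dia2 B))

theorem box1_mono (h : Prov Ax (.imp A B)) : Prov Ax (.imp (.box1 A) (.box1 B)) :=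
  gc2 (trans (dia1_box1 A) h)

theorem box2_mono (h : Prov Ax (.imp A B)) : Prov Ax (.imp (.box2 A) (.box2 B)) :=
  gc4 (trans (dia2_box2 A) h)

theorem box1_nec (h : Prov Ax A) : Prov Ax (.box1 A) :=
  mp (gc2 (weaken h)) (imp_refl A)

theorem box2_nec (h : Prov Ax A) : Prov Ax (.box2 A) :=
  mp (gc4 (weaken h)) (imp_refl A)

theorem and_box1 (A B : Fm) :
    Prov Ax (.imp (.and (.box1 A) (.box1 B)) (.box1 (.and A B))) :=
  gc2 (imp_and (gc1 (and_left _ _)) (gc1 (and_right _ _)))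

theorem and_box2 (A B : Fm) :
    Prov Ax (.imp (.and (.box2 A) (.box2 B)) (.box2 (.and A B))) :=
  gc4 (imp_and (gc3 (and_left _ _)) (gc3 (and_right _ _)))

theorem box1_and_iff (A B : Fm) :
    Prov Ax (Fm.iffF (.box1 (.and A B)) (.and (.box1 A) (.box1 B))) :=
  iffF_intro (imp_and (box1_mono (and_left _ _)) (box1_mono (and_right _ _))) (and_box1 A B)

theorem box2_and_iff (A B : Fm) :
    Prov Ax (Fm.iffF (.box2 (.and A B)) (.and (.box2 A) (.box2 B))) :=
  iffF_intro (imp_and (box2_mono (and_left _ _)) (box2_mono (and_right _ _))) (and_box2 A B)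

theorem dia1_or_iff (A B : Fm) :
    Prov Ax (Fm.iffF (.dia1 (.or A B)) (.or (.dia1 A) (.dia1 B))) :=
  iffF_intro (gc1 (or_imp (gc2 (intAx (.a6 _ _))) (gc2 (intAx (.a7 _ _)))))
    (or_imp (dia1_mono (intAx (.a6 _ _))) (dia1_mono (intAx (.a7 _ _))))

theorem dia2_or_iff (A B : Fm) :
    Prov Ax (Fm.iffF (.dia2 (.or A B)) (.or (.dia2 A) (.dia2 B))) :=
  iffF_intro (gc3 (or_imp (gc4 (intAx (.a6 _ _))) (gc4 (intAx (.a7 _ _)))))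
    (or_imp (dia2_mono (intAx (.a6 _ _))) (dia2_mono (intAx (.a7 _ _))))

theorem box1_imp (A B : Fm) :
    Prov Ax (.imp (.box1 (.imp A B)) (.imp (.box1 A) (.box1 B))) :=
  curry (trans (and_box1 _ _) (box1_mono (uncurry (imp_refl _))))

theorem box2_imp (A B : Fm) :
    Prov Ax (.imp (.box2 (.imp A B)) (.imp (.box2 A) (.box2 B))) :=
  curry (trans (and_box2 _ _) (box2_mono (uncurry (imp_refl _))))

end Basic

section FischerServi

variable {A B C : Fm}

theorem fs1 (A B : Fm) : Prov FSAx (.imp (.dia1 (.imp A B)) (.imp (.box2 A) (.dia1 B))) :=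
  extra (.inl ⟨A, B, rfl⟩)

theorem fs2 (A B : Fm) : Prov FSAx (.imp (.dia2 (.imp A B)) (.imp (.box1 A) (.dia2 B))) :=
  extra (.inr ⟨A, B, rfl⟩)

theorem box2_and_dia1 (h : Prov FSAx (.imp (.and A B) C)) :
    Prov FSAx (.imp (.and (.box2 A) (.dia1 B)) (.dia1 C)) :=
  uncurry (imp_swap (trans (dia1_mono (imp_swap (curry h))) (fs1 A C)))

theorem box1_and_dia2 (h : Prov FSAx (.imp (.and A B) C)) :
    Prov FSAx (.imp (.and (.box1 A) (.dia2 B)) (.dia2 C)) :=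
  uncurry (imp_swap (trans (dia2_mono (imp_swap (curry h))) (fs2 A C)))

theorem of_ikt {A : Fm} (h : IKt A) : Prov FSAx A := by
  induction h with
  | intAx h => exact intAx h
  | mp _ _ h₁ h₂ => exact mp h₁ h₂
  | rG _ h => exact box2_nec h
  | rH _ h => exact box1_nec h
  | ax2 A B => exact box2_imp A B
  | ax2' A B => exact box1_imp A B
  | ax3 A B => exact box2_and_iff A B
  | ax3' A B => exact box1_and_iff A B
  | ax4 A B => exact dia1_or_iff A B
  | ax4' A B => exact dia2_or_iff A B
  | ax5 A B => exact curry (box2_and_dia1 (uncurry (imp_refl _)))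
  | ax5' A B => exact curry (box1_and_dia2 (uncurry (imp_refl _)))
  | ax6 A B => exact box2_and_dia1 (imp_refl _)
  | ax6' A B => exact box1_and_dia2 (imp_refl _)
  | ax7 A =>
    exact imp_neg fun D => trans (box2_and_dia1 (neg_and_self_imp A (.box1 D))) (dia1_box1 D)
  | ax7' A =>
    exact imp_neg fun D => trans (box1_and_dia2 (neg_and_self_imp A (.box2 D))) (dia2_box2 D)
  | ax8 A => exact dia1_box1 A
  | ax8' A => exact dia2_box2 A
  | ax9 A => exact box1_dia1 A
  | ax9' A => exact box2_dia2 A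
  | ax10 A B => exact gc4 (trans (fs2 _ _) (imp_congr (box1_dia1 A) (dia2_box2 B)))
  | ax10' A B => exact gc2 (trans (fs1 _ _) (imp_congr (box2_dia2 A) (dia1_box1 B)))
  | ax11 A B => exact fs1 A B
  | ax11' A B => exact fs2 A B

end FischerServi

end Prov

/-- Ewald's intuitionistic tense logic IK_t is deductively equivalent to Int2GC+FS:
under the identification F = ◆, G = ■, P = ◇, H = □, the two systems prove exactly
the same formulas. -/
theorem ikt_eq_int2gcfs : ∀ A : Fm, IKt A ↔ Prov FSAx A :=
  fun _ => ⟨Prov.of_ikt, IKt.of_prov⟩
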